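/- A real polynomial p(t) = 1 + a_1 t + \cdots + a_m t^m factors as p(t) = (1 + x_1 t)(1 + x_2 t) \cdots (1 + x_m t) with all x_i \ge 0 real if and only if the infinite Toeplitz matrix with (i,j)-entry a_{j-i} (where a_0 = 1 and a_k = 0 for k < 0 or k > m) is totally nonnegative, i.e., all its finite minors are nonnegative. -/

import Mathlib

open Polynomial

/-- Total nonnegativity of the Toeplitz kernel `(i, j) ↦ f (j - i)`. -/
def ToeplitzNonneg (f : ℤ → ℝ) : Prop :=
  ∀ (k : ℕ) (r c : Fin k → ℤ), StrictMono r → StrictMono c →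
    0 ≤ Matrix.det (Matrix.of fun i j => f (c j - r i))

theorem ToeplitzNonneg.det_nonneg_of_monotone {f : ℤ → ℝ} (hf : ToeplitzNonneg f) {k : ℕ}
    {r c : Fin k → ℤ} (hr : StrictMono r) (hc : Monotone c) :
    0 ≤ Matrix.det (Matrix.of fun i j => f (c j - r i)) := by
  by_cases hi : Function.Injective c
  · exact hf k r c hr (hc.strictMono_of_injective hi)
  · simp only [Function.Injective, not_forall] at hi
    obtain ⟨i, j, hij, hne⟩ := hi
    exact (Matrix.det_zero_of_column_eq hne (fun l => by simp [hij])).ge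

/-- The coefficient sequence of `(1 + x t) f(t)`. -/
def mulLinear (x : ℝ) (f : ℤ → ℝ) (n : ℤ) : ℝ := f n + x * f (n - 1)

theorem det_mulLinear (x : ℝ) (f : ℤ → ℝ) {k : ℕ} (r c : Fin k → ℤ) :
    Matrix.det (Matrix.of fun i j => mulLinear x f (c j - r i)) =
      ∑ s : Finset (Fin k), (∏ j, if j ∈ s then 1 else x) *
        Matrix.det (Matrix.of fun i j => f ((c j - if j ∈ s then 0 else 1) - r i)) := by
  rw [← Matrix.det_transpose]
  have h := (Matrix.detRowAlternating (n := Fin k) (R := ℝ)).toMultilinearMap.map_add_univ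
    (fun j i => f (c j - r i)) (fun j i => x * f (c j - 1 - r i))
  refine Eq.trans ?_ (h.trans ?_)
  · change Matrix.det _ = Matrix.det _
    congr 1
    ext j i
    simp only [Matrix.transpose_apply, Matrix.of_apply, mulLinear, Pi.add_apply]
    rw [sub_right_comm]
  · refine Finset.sum_congr rfl fun s _ => ?_
    rw [← Matrix.det_mul_row, ← Matrix.det_transpose]
    change Matrix.det _ = Matrix.det _
    congr 1
    ext j i
    by_cases hj : j ∈ s <;> simp [Finset.piecewise, hj]

theorem det_mulLinear_term_nonneg {x : ℝ} (hx : 0 ≤ x) {f : ℤ → ℝ} (hf : ToeplitzNonneg f) {k : ℕ}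
    {r c : Fin k → ℤ} (hr : StrictMono r) (hc : StrictMono c) (s : Finset (Fin k)) :
    0 ≤ (∏ j, if j ∈ s then 1 else x) *
        Matrix.det (Matrix.of fun i j => f ((c j - if j ∈ s then 0 else 1) - r i)) := by
  refine mul_nonneg (Finset.prod_nonneg fun j _ => by split_ifs <;> simp [hx])
    (hf.det_nonneg_of_monotone (c := fun j => c j - if j ∈ s then 0 else 1) hr ?_)
  intro i j hij
  rcases hij.eq_or_lt with rfl | h
  · exact le_rfl
  · have := hc h
    dsimp only
    split_ifs <;> omega

theorem ToeplitzNonneg.mulLinear {x : ℝ} (hx : 0 ≤ x) {f : ℤ → ℝ} (hf : ToeplitzNonneg f) :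
    ToeplitzNonneg (mulLinear x f) := fun k r c hr hc => by
  rw [det_mulLinear]
  exact Finset.sum_nonneg fun s _ => det_mulLinear_term_nonneg hx hf hr hc s

theorem ToeplitzNonneg.le_det_mulLinear_one {f : ℤ → ℝ} (hf : ToeplitzNonneg f) {k : ℕ}
    {r c c' : Fin k → ℤ} (hr : StrictMono r) (hc : StrictMono c)
    (h : ∀ j, c' j = c j ∨ c' j = c j - 1) :
    Matrix.det (Matrix.of fun i j => f (c' j - r i)) ≤
      Matrix.det (Matrix.of fun i j => _root_.mulLinear 1 f (c j - r i)) := by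
  rw [det_mulLinear]
  refine le_trans (le_of_eq ?_) (Finset.single_le_sum
    (fun s _ => det_mulLinear_term_nonneg zero_le_one hf hr hc s)
    (Finset.mem_univ (Finset.univ.filter fun j => c' j = c j)))
  simp only [ite_self, Finset.prod_const_one, one_mul]
  congr 1
  ext i j
  simp only [Matrix.of_apply, Finset.mem_filter, Finset.mem_univ, true_and]
  split_ifs with hj
  · rw [hj, sub_zero]
  · rw [(h j).resolve_left hj]

theorem ToeplitzNonneg.iterate_mulLinear_one {f : ℤ → ℝ} (hf : ToeplitzNonneg f) (N : ℕ) :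
    ToeplitzNonneg ((_root_.mulLinear 1)^[N] f) := by
  induction N with
  | zero => exact hf
  | succ N ih =>
    rw [Function.iterate_succ_apply']
    exact ih.mulLinear zero_le_one

theorem ToeplitzNonneg.det_iterate_mulLinear_one_pos {f : ℤ → ℝ} (hf : ToeplitzNonneg f) {k : ℕ}
    {r b : Fin k → ℤ} (hr : StrictMono r) (hb : StrictMono b)
    (hpos : 0 < Matrix.det (Matrix.of fun i j => f (b j - r i))) (N : ℕ) {c : Fin k → ℤ}
    (hc : StrictMono c) (hbc : ∀ j, b j ≤ c j) (hcb : ∀ j, c j ≤ b j + N) :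
    0 < Matrix.det (Matrix.of fun i j => (_root_.mulLinear 1)^[N] f (c j - r i)) := by
  induction N generalizing c with
  | zero =>
    obtain rfl : b = c := funext fun j => le_antisymm (hbc j) (by simpa using hcb j)
    exact hpos
  | succ N ih =>
    have hm : StrictMono fun j => max (b j) (c j - 1) := fun i j hij => by
      have := hb hij
      have := hc hij
      simp only [lt_max_iff, max_lt_iff]
      omega
    have hlt := ih (c := fun j => max (b j) (c j - 1)) hm (fun j => le_max_left _ _) (fun j => by
      have := hcb j
      push_cast at this
      exact max_le (by omega) (by omega))
    rw [Function.iterate_succ_apply']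
    refine hlt.trans_le ((hf.iterate_mulLinear_one N).le_det_mulLinear_one hr hc fun j => ?_)
    have := hbc j
    rcases le_total (b j) (c j - 1) with h | h
    · exact Or.inr (max_eq_right h)
    · rw [max_eq_left h]
      omega

/-- The coefficients of a polynomial, extended by zero to negative indices. -/
def intCoeff (p : ℝ[X]) (n : ℤ) : ℝ := if n < 0 then 0 else p.coeff n.toNat

theorem intCoeff_of_neg (p : ℝ[X]) {n : ℤ} (hn : n < 0) : intCoeff p n = 0 := if_pos hn

@[simp] theorem intCoeff_natCast (p : ℝ[X]) (n : ℕ) : intCoeff p n = p.coeff n := by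
  simp [intCoeff]

theorem intCoeff_of_natDegree_lt (p : ℝ[X]) {n : ℤ} (hn : (p.natDegree : ℤ) < n) :
    intCoeff p n = 0 := by
  rw [intCoeff, if_neg (by omega)]
  exact coeff_eq_zero_of_natDegree_lt (by omega)

theorem intCoeff_linear_mul (x : ℝ) (p : ℝ[X]) :
    intCoeff ((1 + C x * X) * p) = mulLinear x (intCoeff p) := by
  ext n
  rcases lt_or_ge n 0 with hn | hn
  · simp [mulLinear, intCoeff_of_neg _ hn, intCoeff_of_neg p (show n - 1 < 0 by omega)]
  · lift n to ℕ using hn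
    rw [mulLinear, intCoeff_natCast, intCoeff_natCast]
    cases n with
    | zero => simp [intCoeff, mul_assoc, add_mul]
    | succ n =>
      have : ((n + 1 : ℕ) : ℤ) - 1 = n := by push_cast; ring
      rw [this, intCoeff_natCast, add_mul, one_mul, coeff_add, mul_assoc, coeff_C_mul, coeff_X_mul]

theorem intCoeff_one_add_X_pow_mul (p : ℝ[X]) (N : ℕ) :
    intCoeff ((1 + X) ^ N * p) = (mulLinear 1)^[N] (intCoeff p) := by
  induction N with
  | zero => simp
  | succ N ih =>
    rw [Function.iterate_succ_apply', ← ih, ← intCoeff_linear_mul]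
    congr 1
    simp only [map_one, one_mul]
    ring

theorem toeplitzNonneg_intCoeff_one : ToeplitzNonneg (intCoeff 1) := by
  intro k r c hr hc
  have hval : ∀ n : ℤ, intCoeff 1 n = if n = 0 then 1 else 0 := fun n => by
    rcases lt_or_ge n 0 with hn | hn
    · rw [intCoeff_of_neg _ hn, if_neg hn.ne]
    · lift n to ℕ using hn
      simp [coeff_one]
  by_cases h : ∀ j, ∃ i, c j = r i
  · have hcr : c = r := by
      refine (hc.range_inj hr).1 (Set.eq_of_subset_of_ncard_le ?_ ?_)
      · rintro _ ⟨j, rfl⟩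
        obtain ⟨i, hi⟩ := h j
        exact ⟨i, hi.symm⟩
      · rw [← Set.image_univ, ← Set.image_univ, Set.ncard_image_of_injective _ hr.injective,
          Set.ncard_image_of_injective _ hc.injective]
    subst hcr
    have : (Matrix.of fun i j => intCoeff 1 (c j - c i)) = (1 : Matrix (Fin k) (Fin k) ℝ) := by
      ext i j
      simp [hval, sub_eq_zero, Matrix.one_apply, hc.injective.eq_iff, eq_comm]
    rw [this, Matrix.det_one]
    exact zero_le_one
  · push Not at h
    obtain ⟨j, hj⟩ := h
    refine (Matrix.det_eq_zero_of_column_eq_zero j fun i => ?_).ge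
    simp [hval, sub_eq_zero, hj i]

theorem toeplitzNonneg_intCoeff_prod {ι : Type*} (s : Finset ι) (x : ι → ℝ)
    (hx : ∀ i, 0 ≤ x i) : ToeplitzNonneg (intCoeff (∏ i ∈ s, (1 + C (x i) * X))) := by
  classical
  induction s using Finset.induction_on with
  | empty => simpa using toeplitzNonneg_intCoeff_one
  | insert i s hi ih =>
    rw [Finset.prod_insert hi, intCoeff_linear_mul]
    exact ih.mulLinear (hx i)

theorem det_of_blockTriangular_injective {m : Type*} [Fintype m] [DecidableEq m]
    {M : Matrix m m ℝ} {b : m → ℤ} (hb : Function.Injective b) (hM : M.BlockTriangular b) :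
    M.det = ∏ i, M i i := by
  let _ : LinearOrder m := LinearOrder.lift' b hb
  convert Matrix.det_of_isUpperTriangular (M := M) fun i j hij => hM hij

theorem det_insertNth (f : ℤ → ℝ) {R : ℕ} (r : Fin (R + 1) → ℤ) (J : Fin R → ℤ)
    (l : Fin (R + 1)) (k : ℤ) :
    Matrix.det (Matrix.of fun i j => f (l.insertNth (α := fun _ => ℤ) k J j - r i)) =
      (-1) ^ (l : ℕ) * ∑ i : Fin (R + 1), (-1) ^ (i : ℕ) *
        Matrix.det (Matrix.of fun s t => f (J t - r (i.succAbove s))) * f (k - r i) := by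
  rw [Matrix.det_succ_column _ l, Finset.mul_sum]
  refine Finset.sum_congr rfl fun i _ => ?_
  have : (Matrix.of fun i j => f (l.insertNth (α := fun _ => ℤ) k J j - r i)).submatrix
      i.succAbove l.succAbove = Matrix.of fun s t => f (J t - r (i.succAbove s)) := by
    ext s t
    simp
  rw [this, Matrix.of_apply, Fin.insertNth_apply_same]
  ring

theorem monotone_insertNth {R : ℕ} {J : Fin R → ℤ} (hJ : Monotone J) (l : Fin (R + 1)) (k : ℤ)
    (h₁ : ∀ t : Fin R, t.val < l.val → J t ≤ k) (h₂ : ∀ t : Fin R, l.val ≤ t.val → k ≤ J t) :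
    Monotone (l.insertNth (α := fun _ => ℤ) k J) := by
  intro i j hij
  induction i using l.succAboveCases with
  | x =>
    induction j using l.succAboveCases with
    | x => exact le_rfl
    | p t =>
      simp only [Fin.insertNth_apply_same, Fin.insertNth_apply_succAbove]
      refine h₂ t ?_
      by_contra! h
      rw [Fin.succAbove_of_castSucc_lt _ _ h] at hij
      exact absurd hij (not_le.2 h)
  | p s =>
    induction j using l.succAboveCases with
    | x =>
      simp only [Fin.insertNth_apply_same, Fin.insertNth_apply_succAbove]
      refine h₁ s ?_
      by_contra! h
      rw [Fin.succAbove_of_le_castSucc _ _ h] at hij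
      have : s.val + 1 ≤ l.val := hij
      omega
    | p t =>
      simp only [Fin.insertNth_apply_succAbove]
      exact hJ (l.strictMono_succAbove.le_iff_le.1 hij)

theorem det_split_pos {f : ℤ → ℝ} {d : ℕ} (hneg : ∀ n < 0, f n = 0) (h0 : 0 < f 0)
    (hd : 0 < f d) (hhigh : ∀ n : ℤ, d < n → f n = 0) (k u : ℕ) :
    0 < Matrix.det (Matrix.of fun i j : Fin k =>
      f (((j : ℕ) + if (j : ℕ) < u then (0 : ℤ) else d) - (i : ℕ))) := by
  rw [det_of_blockTriangular_injective
    (b := fun i : Fin k => if (i : ℕ) < u then ((i : ℕ) : ℤ) else u + k - (i : ℕ))]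
  · refine Finset.prod_pos fun i _ => ?_
    simp only [Matrix.of_apply]
    split_ifs
    · simpa using h0
    · simpa using hd
  · intro i j hij
    have := i.isLt
    have := j.isLt
    ext
    dsimp only at hij
    split_ifs at hij <;> omega
  · intro i j hij
    have := i.isLt
    have := j.isLt
    simp only [Matrix.of_apply]
    dsimp only at hij
    split_ifs at hij ⊢
    · exact hneg _ (by omega)
    · exact hneg _ (by omega)
    · omega
    · exact hhigh _ (by omega)

theorem coeff_sum_mul_eq (P : ℝ[X]) {R : ℕ} (q : Fin R → ℝ) (k : ℕ) :
    ((∑ i, C (q i) * X ^ (i : ℕ)) * P).coeff k = ∑ i, q i * intCoeff P (k - (i : ℕ)) := by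
  rw [Finset.sum_mul, finsetSum_coeff]
  refine Finset.sum_congr rfl fun i _ => ?_
  rw [mul_assoc, coeff_C_mul, coeff_X_pow_mul']
  split_ifs with h
  · rw [← Nat.cast_sub h, intCoeff_natCast]
  · rw [intCoeff_of_neg _ (by omega)]

/-- An alternating-sign estimate for the sine. -/
theorem neg_one_pow_mul_sin_nonneg {θ : ℝ} {l : ℕ} (h₁ : l * Real.pi ≤ θ)
    (h₂ : θ ≤ (l + 1) * Real.pi) : 0 ≤ (-1) ^ l * Real.sin θ := by
  rw [← Real.sin_sub_nat_mul_pi]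
  exact Real.sin_nonneg_of_nonneg_of_le_pi (by linarith) (by linarith)

theorem sum_coeff_mul_sin_eq_zero {G : ℝ[X]} {z : ℂ} (hG : aeval z G = 0) {M : ℕ}
    (hM : G.natDegree < M) :
    ∑ k ∈ Finset.range M, G.coeff k * (‖z‖ ^ k * Real.sin (k * z.arg)) = 0 := by
  have h := congrArg Complex.im hG
  rw [aeval_eq_sum_range' hM, Complex.im_sum, Complex.zero_im] at h
  rw [← h]
  refine Finset.sum_congr rfl fun k _ => ?_
  rw [Complex.smul_im, smul_eq_mul]
  congr 1
  conv_rhs => rw [← Complex.norm_mul_exp_arg_mul_I z, mul_pow, ← Complex.exp_nat_mul,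
    ← Complex.ofReal_pow, Complex.im_ofReal_mul, ← mul_assoc, ← Complex.ofReal_natCast,
    ← Complex.ofReal_mul, Complex.exp_ofReal_mul_I_im]

/-- The integers `1, ⌈β⌉, ⌈2β⌉, ⌈3β⌉, …`. -/
noncomputable def ceilMultiples (β : ℝ) (s : ℕ) : ℤ := if s = 0 then 1 else ⌈s * β⌉

theorem ceilMultiples_succ (β : ℝ) (s : ℕ) : ceilMultiples β (s + 1) = ⌈(s + 1) * β⌉ := by
  simp [ceilMultiples]

theorem ceilMultiples_add_one_le {β : ℝ} (hβ : 1 < β) (s : ℕ) :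
    ceilMultiples β s + 1 ≤ ceilMultiples β (s + 1) := by
  rw [ceilMultiples_succ]
  cases s with
  | zero =>
    have : (1 : ℤ) < ⌈β⌉ := Int.lt_ceil.2 (by simpa using hβ)
    simp only [ceilMultiples, if_true, Nat.cast_zero, zero_add, one_mul]
    omega
  | succ s =>
    rw [ceilMultiples_succ, ← Int.ceil_add_one]
    refine Int.ceil_le_ceil ?_
    push_cast
    nlinarith

theorem monotone_ceilMultiples_sub {β : ℝ} (hβ : 1 < β) :
    Monotone fun s : ℕ => ceilMultiples β s - s :=
  monotone_nat_of_le_succ fun s => by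
    have := ceilMultiples_add_one_le hβ s
    push_cast
    omega

theorem exists_le_ceilMultiples_sub {β : ℝ} (hβ : 1 < β) (B : ℤ) :
    ∃ s : ℕ, B ≤ ceilMultiples β s - s := by
  obtain ⟨n, hn⟩ := exists_nat_ge ((B : ℝ) / (β - 1))
  rw [div_le_iff₀ (by linarith)] at hn
  refine ⟨n + 1, ?_⟩
  rw [ceilMultiples_succ]
  have h := Int.le_ceil (((n : ℝ) + 1) * β)
  have : (B : ℝ) ≤ (⌈((n : ℝ) + 1) * β⌉ : ℝ) - (n + 1) := by nlinarith
  exact_mod_cast this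

theorem ToeplitzNonneg.coeff_nonneg {p : ℝ[X]} (hp : ToeplitzNonneg (intCoeff p)) (n : ℕ) :
    0 ≤ p.coeff n := by
  simpa using hp 1 (fun _ => 0) (fun _ => n) (Subsingleton.strictMono _)
    (Subsingleton.strictMono _)

theorem isRoot_of_aeval_ofReal_eq_zero {p : ℝ[X]} {y : ℝ} (h : aeval (y : ℂ) p = 0) :
    p.IsRoot y := by
  have h' : aeval (y : ℂ) p = ((eval y p : ℝ) : ℂ) :=
    aeval_algebraMap_apply_eq_algebraMap_eval y p
  rw [h'] at h
  exact_mod_cast h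

theorem ToeplitzNonneg.im_nonpos_of_aeval_eq_zero {p : ℝ[X]} (h0 : p.coeff 0 = 1)
    (hp : ToeplitzNonneg (intCoeff p)) {z : ℂ} (hz : aeval z p = 0) : z.im ≤ 0 := by
  by_contra! him
  have hz0 : z ≠ 0 := by rintro rfl; simp at him
  have hp0 : p ≠ 0 := by rintro rfl; simp at h0
  have hα0 : 0 < z.arg := by
    refine lt_of_le_of_ne (Complex.arg_nonneg_iff.2 him.le) fun h => ?_
    exact him.ne' (Complex.arg_eq_zero_iff.1 h.symm).2
  have hαπ : z.arg < Real.pi := Complex.arg_lt_pi_iff.2 (Or.inr him.ne')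
  obtain ⟨β, hβ⟩ : ∃ β, β = Real.pi / z.arg := ⟨_, rfl⟩
  have hβα : β * z.arg = Real.pi := by rw [hβ]; field_simp
  have hβ1 : 1 < β := by rw [hβ]; exact (one_lt_div hα0).2 hαπ
  have hsin : 0 < Real.sin z.arg := Real.sin_pos_of_pos_of_lt_pi hα0 hαπ
  have hd : 0 < p.natDegree := by
    by_contra! h
    rw [eq_C_of_natDegree_le_zero h, h0] at hz
    simp at hz
  have hlead : 0 < p.coeff p.natDegree :=
    lt_of_le_of_ne (hp.coeff_nonneg _) (leadingCoeff_ne_zero.2 hp0).symm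
  generalize hdd : p.natDegree = d at hd hlead
  have hmono := monotone_ceilMultiples_sub hβ1
  have hstrict : StrictMono (ceilMultiples β) := strictMono_nat_of_lt_succ fun s => by
    have := ceilMultiples_add_one_le hβ1 s
    omega
  obtain ⟨u, hu⟩ := exists_le_ceilMultiples_sub hβ1 d
  obtain ⟨R, hR⟩ := exists_le_ceilMultiples_sub hβ1 (ceilMultiples β u - u + d)
  have hR0 : R ≠ 0 := by
    rintro rfl
    have := hmono (Nat.zero_le u)
    dsimp only at this
    omega
  obtain ⟨N, hN⟩ := Int.eq_ofNat_of_zero_le (a := ceilMultiples β R - R - d) (by omega)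
  have hr : StrictMono fun i : Fin (R + 1) => ((i : ℕ) : ℤ) := fun i j hij => by
    simpa using hij
  have hdet : 0 < Matrix.det (Matrix.of fun i j : Fin (R + 1) =>
      intCoeff ((1 + X) ^ N * p) (ceilMultiples β j - (i : ℕ))) := by
    rw [intCoeff_one_add_X_pow_mul]
    refine hp.det_iterate_mulLinear_one_pos (r := fun i : Fin (R + 1) => ((i : ℕ) : ℤ))
      (b := fun j => (j : ℕ) + if (j : ℕ) < u then (0 : ℤ) else d)
      (c := fun j => ceilMultiples β j) hr ?_ ?_ N ?_ ?_ ?_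
    · intro i j hij
      have : (i : ℕ) < j := hij
      dsimp only
      split_ifs <;> omega
    · refine det_split_pos (fun n => intCoeff_of_neg p) ?_ ?_ (fun n hn => ?_) _ _
      · exact zero_lt_one.trans_eq (h0.symm.trans (intCoeff_natCast p 0).symm)
      · simpa using hlead
      · exact intCoeff_of_natDegree_lt p (hdd ▸ hn)
    · exact fun i j hij => hstrict hij
    · intro j
      have h₁ := hmono (Nat.zero_le j)
      have h₂ : ceilMultiples β 0 = 1 := rfl
      dsimp only at h₁ ⊢
      split_ifs with h
      · omega
      · have := hmono (not_lt.1 h)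
        dsimp only at this
        omega
    · intro j
      have h₁ := hmono (Nat.le_of_lt_succ j.isLt)
      dsimp only at h₁ ⊢
      split_ifs with h
      · have := hmono h.le
        dsimp only at this
        omega
      · omega
  have hP : ToeplitzNonneg (intCoeff ((1 + X) ^ N * p)) := by
    rw [intCoeff_one_add_X_pow_mul]
    exact hp.iterate_mulLinear_one N
  have hPdeg : ((1 + X) ^ N * p).natDegree ≤ N + d := by
    refine natDegree_mul_le.trans (add_le_add (natDegree_pow_le.trans ?_) hdd.le)
    refine (Nat.mul_le_mul_left N (natDegree_add_le _ _)).trans ?_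
    simp
  have hPz : aeval z ((1 + X) ^ N * p) = 0 := by rw [map_mul, hz, mul_zero]
  generalize (1 + X) ^ N * p = P at hdet hP hPdeg hPz
  let J : Fin R → ℤ := fun t => ceilMultiples β (t + 1)
  let q : Fin (R + 1) → ℝ := fun i => (-1) ^ (i : ℕ) *
    Matrix.det (Matrix.of fun s t => intCoeff P (J t - ((i.succAbove s : ℕ) : ℤ)))
  obtain ⟨G, hG⟩ : ∃ G, G = (∑ i, C (q i) * X ^ (i : ℕ)) * P := ⟨_, rfl⟩
  have hins : ∀ (l : Fin (R + 1)) (k : ℕ), Matrix.det (Matrix.of fun i j =>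
      intCoeff P (l.insertNth (α := fun _ => ℤ) k J j - ((i : ℕ) : ℤ))) =
      (-1) ^ (l : ℕ) * G.coeff k := fun l k => by
    rw [hG, coeff_sum_mul_eq]
    exact det_insertNth (intCoeff P) (fun i => ((i : ℕ) : ℤ)) J l k
  have hG1 : 0 < G.coeff 1 := by
    have h := hins 0 1
    rw [Fin.val_zero, pow_zero, one_mul] at h
    rw [← h]
    convert hdet using 6 with i j
    induction j using Fin.cases with
    | zero => simp [ceilMultiples]
    | succ t => simp [J]
  have hGdeg : G.natDegree < R + d + N + 1 := by
    rw [hG]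
    refine Nat.lt_succ_of_le (natDegree_mul_le.trans ?_)
    have : (∑ i : Fin (R + 1), C (q i) * X ^ (i : ℕ)).natDegree ≤ R :=
      natDegree_sum_le_of_forall_le _ _ fun i _ =>
        (natDegree_C_mul_X_pow_le _ _).trans (Nat.le_of_lt_succ i.isLt)
    omega
  have hsum := sum_coeff_mul_sin_eq_zero (G := G) (z := z) (by rw [hG, map_mul, hPz, mul_zero])
    hGdeg
  have hnonneg : ∀ k ∈ Finset.range (R + d + N + 1),
      0 ≤ G.coeff k * (‖z‖ ^ k * Real.sin (k * z.arg)) := by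
    intro k hk
    rw [Finset.mem_range] at hk
    have hβ0 : 0 < β := by linarith
    obtain ⟨l, hl⟩ : ∃ l, l = ⌊(k : ℝ) / β⌋₊ := ⟨_, rfl⟩
    have hl₁ : l * β ≤ k := by
      rw [← le_div_iff₀ hβ0, hl]
      exact Nat.floor_le (by positivity)
    have hl₂ : k < (l + 1) * β := by
      rw [← div_lt_iff₀ hβ0, hl]
      exact Nat.lt_floor_add_one _
    have hlR : l < R + 1 := by
      have h₁ : (k : ℤ) ≤ ⌈(R : ℝ) * β⌉ := by
        have : ceilMultiples β R = ⌈(R : ℝ) * β⌉ := if_neg hR0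
        omega
      have h₂ : (k : ℝ) ≤ ⌈(R : ℝ) * β⌉ := by exact_mod_cast h₁
      have h₃ := Int.ceil_lt_add_one ((R : ℝ) * β)
      have h₄ : (l : ℝ) * β < (R + 1) * β := by linarith
      exact_mod_cast lt_of_mul_lt_mul_right h₄ hβ0.le
    have hJ : Monotone J := fun s t hst => hstrict.monotone (Nat.succ_le_succ hst)
    have hGk : 0 ≤ (-1) ^ l * G.coeff k := by
      rw [← hins ⟨l, hlR⟩ k]
      refine hP.det_nonneg_of_monotone hr (monotone_insertNth hJ _ _ ?_ ?_)
      · intro t ht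
        have ht' : ((t : ℕ) : ℝ) + 1 ≤ l := by exact_mod_cast ht
        simp only [J]
        rw [ceilMultiples_succ, Int.ceil_le]
        push_cast
        exact (mul_le_mul_of_nonneg_right ht' hβ0.le).trans hl₁
      · intro t ht
        have ht' : (l : ℝ) ≤ (t : ℕ) := by exact_mod_cast ht
        simp only [J]
        rw [ceilMultiples_succ]
        have h₁ : (k : ℝ) ≤ ⌈(((t : ℕ) : ℝ) + 1) * β⌉ :=
          (hl₂.le.trans (mul_le_mul_of_nonneg_right (by linarith) hβ0.le)).trans (Int.le_ceil _)
        exact_mod_cast h₁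
    have hs : 0 ≤ (-1) ^ l * Real.sin (k * z.arg) := by
      refine neg_one_pow_mul_sin_nonneg ?_ ?_ <;> rw [← hβα, ← mul_assoc]
      · exact mul_le_mul_of_nonneg_right hl₁ hα0.le
      · exact mul_le_mul_of_nonneg_right hl₂.le hα0.le
    have hsq : ((-1 : ℝ) ^ l) * (-1) ^ l = 1 := by rw [← mul_pow]; simp
    calc 0 ≤ ‖z‖ ^ k * (((-1) ^ l * G.coeff k) * ((-1) ^ l * Real.sin (k * z.arg))) := by
          positivity
      _ = ((-1) ^ l * (-1) ^ l) * (G.coeff k * (‖z‖ ^ k * Real.sin (k * z.arg))) := by ring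
      _ = _ := by rw [hsq, one_mul]
  have h1 := (Finset.sum_eq_zero_iff_of_nonneg hnonneg).1 hsum 1 (by simp; omega)
  have : 0 < G.coeff 1 * (‖z‖ ^ 1 * Real.sin ((1 : ℕ) * z.arg)) := by
    have := norm_pos_iff.2 hz0
    rw [Nat.cast_one, one_mul]
    positivity
  exact this.ne' h1

theorem ToeplitzNonneg.exists_neg_of_aeval_eq_zero {p : ℝ[X]} (h0 : p.coeff 0 = 1)
    (hp : ToeplitzNonneg (intCoeff p)) {z : ℂ} (hz : aeval z p = 0) :
    ∃ y : ℝ, y < 0 ∧ z = y := by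
  have h₁ := hp.im_nonpos_of_aeval_eq_zero h0 hz
  have h₂ := hp.im_nonpos_of_aeval_eq_zero (z := (starRingEnd ℂ) z) h0 (by
    rw [aeval_conj, hz, map_zero])
  rw [Complex.conj_im] at h₂
  have hre : z = (z.re : ℂ) := Complex.ext rfl (by simp; linarith)
  refine ⟨z.re, ?_, hre⟩
  by_contra! hy
  rw [hre] at hz
  have hz' : eval z.re p = 0 := isRoot_of_aeval_ofReal_eq_zero hz
  rw [eval_eq_sum_range, Finset.sum_range_succ'] at hz'
  have : 0 ≤ ∑ k ∈ Finset.range p.natDegree, p.coeff (k + 1) * z.re ^ (k + 1) :=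
    Finset.sum_nonneg fun k _ => mul_nonneg (hp.coeff_nonneg _) (pow_nonneg hy _)
  simp only [h0, pow_zero, mul_one] at hz'
  linarith

theorem exists_eq_prod_one_add_of_roots_neg (m : ℕ) (p : ℝ[X]) (h0 : p.coeff 0 = 1)
    (hm : p.natDegree ≤ m) (hroots : ∀ z : ℂ, aeval z p = 0 → ∃ y : ℝ, y < 0 ∧ z = y) :
    ∃ x : Fin m → ℝ, (∀ i, 0 ≤ x i) ∧ ∏ i, (1 + C (x i) * X) = p := by
  induction m generalizing p with
  | zero =>
    refine ⟨Fin.elim0, fun i => i.elim0, ?_⟩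
    rw [eq_C_of_natDegree_le_zero hm, h0]
    simp
  | succ m ih =>
    by_cases hd : p.natDegree = 0
    · refine ⟨0, fun i => le_rfl, ?_⟩
      rw [eq_C_of_natDegree_le_zero hd.le, h0]
      simp
    · obtain ⟨z, hz⟩ := IsAlgClosed.exists_aeval_eq_zero ℂ p (degree_ne_of_natDegree_ne hd)
      obtain ⟨y, hy, rfl⟩ := hroots z hz
      obtain ⟨q, rfl⟩ := dvd_iff_isRoot.2 (isRoot_of_aeval_ofReal_eq_zero hz)
      have hfac : (X - C y) * q = (1 + C (-y⁻¹) * X) * (C (-y) * q) := by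
        have : C (-y⁻¹) * C (-y) = (1 : ℝ[X]) := by
          rw [← C_mul, neg_mul_neg, inv_mul_cancel₀ hy.ne, C_1]
        have hC : C (-y) = -(C y : ℝ[X]) := C_neg
        linear_combination (-(X * q)) * this + (-q) * hC
      rw [hfac] at h0 hm hroots hd ⊢
      have hlin : (1 + C (-y⁻¹) * X : ℝ[X]).natDegree = 1 := by
        rw [add_comm, ← C_1]
        exact natDegree_linear (neg_ne_zero.2 (inv_ne_zero hy.ne))
      obtain ⟨x, hx, hxq⟩ := ih (C (-y) * q) (by simpa [mul_coeff_zero] using h0) (by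
        rw [natDegree_mul (fun h => by rw [h] at hlin; simp at hlin)
          (fun h => by rw [h] at h0; simp at h0), hlin] at hm
        omega) fun z hz => hroots z (by rw [map_mul, hz, mul_zero])
      refine ⟨Fin.cons (-y⁻¹) x, fun i => ?_, ?_⟩
      · induction i using Fin.cases with
        | zero => simpa using hy.le
        | succ i => simpa using hx i
      · rw [Fin.prod_univ_succ]
        simp only [Fin.cons_zero, Fin.cons_succ]
        rw [hxq]

/-- A real polynomial `p(t) = 1 + a₁ t + ⋯ + a_m t^m` factors as
`(1 + x₁ t) ⋯ (1 + x_m t)` with all `x_i ≥ 0` if and only if the infinite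
Toeplitz matrix with `(i,j)`-entry `a_{j-i}` (with `a₀ = 1`, `a_k = 0` for
`k < 0` or `k > m`) is totally nonnegative: every finite minor is nonnegative. -/
theorem toeplitz_totally_nonneg_iff_factorization
    (m : ℕ) (a : ℤ → ℝ) (h0 : a 0 = 1)
    (hneg : ∀ k : ℤ, k < 0 → a k = 0) (hhigh : ∀ k : ℤ, (m : ℤ) < k → a k = 0) :
    (∃ x : Fin m → ℝ, (∀ i, 0 ≤ x i) ∧
        (∏ i : Fin m, (1 + C (x i) * X)) =
          ∑ k ∈ Finset.range (m + 1), C (a (k : ℤ)) * X ^ k) ↔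
      (∀ (k : ℕ) (r c : Fin k → ℤ), StrictMono r → StrictMono c →
        0 ≤ Matrix.det (Matrix.of fun i j => a (c j - r i))) := by
  obtain ⟨p, hp⟩ : ∃ p, p = ∑ k ∈ Finset.range (m + 1), C (a (k : ℤ)) * X ^ k := ⟨_, rfl⟩
  have hcoeff : intCoeff p = a := by
    ext n
    rcases lt_or_ge n 0 with hn | hn
    · rw [intCoeff_of_neg _ hn, hneg n hn]
    · lift n to ℕ using hn
      rw [intCoeff_natCast, hp, finsetSum_coeff]
      simp only [coeff_C_mul_X_pow, Finset.sum_ite_eq, Finset.mem_range]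
      split_ifs with h
      · rfl
      · rw [hhigh n (by omega)]
  rw [← hp]
  constructor
  · rintro ⟨x, hx, h⟩
    have := toeplitzNonneg_intCoeff_prod Finset.univ x hx
    rwa [h, hcoeff] at this
  · intro h
    have hTN : ToeplitzNonneg (intCoeff p) := by rwa [hcoeff]
    have hp0 : p.coeff 0 = 1 := by
      rw [← intCoeff_natCast, hcoeff]
      exact h0
    refine exists_eq_prod_one_add_of_roots_neg m p hp0 ?_ fun z hz =>
      hTN.exists_neg_of_aeval_eq_zero hp0 hz
    rw [hp]
    exact natDegree_sum_le_of_forall_le _ _ fun k hk =>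
      (natDegree_C_mul_X_pow_le _ _).trans (Nat.le_of_lt_succ (Finset.mem_range.1 hk))
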